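/- Let 0 < N ≤ 1. Then the function a ↦ α(a) is strictly monotone decreasing on ℝ. Moreover, for a real number α₀, there exists a radial solution at level α₀ if and only if α₀ ∈ (2, 2(N+1)), and in that case the radial solution is unique. -/

import Mathlib

open Real Set MeasureTheory Filter

noncomputable section

/-- `u` is a radial solution of the Liouville equation
`u'' + u'/r + (1+r²)^N e^{2u} = 0` on `(0,∞)`, of class `C²` on `[0,∞)`,
with `u'(0) = 0` and finite mass `∫₀^∞ (1+r²)^N e^{2u} r dr < ∞`. -/
def IsSol (N : ℝ) (u : ℝ → ℝ) : Prop :=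
  ContDiffOn ℝ 2 u (Ici 0) ∧
  (∀ r : ℝ, 0 < r →
    deriv (deriv u) r + deriv u r / r + (1 + r ^ 2) ^ N * Real.exp (2 * u r) = 0) ∧
  derivWithin u (Ici 0) 0 = 0 ∧
  IntegrableOn (fun r => (1 + r ^ 2) ^ N * Real.exp (2 * u r) * r) (Ioi 0)

/-- `u` is a radial solution at level `α₀`: a `C²([0,∞))` solution of
`u'' + u'/r + (1+r²)^N e^{2u} = 0` on `(0,∞)` with `u'(0) = 0` and
`∫₀^∞ (1+r²)^N e^{2u} r dr = α₀`. -/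
def IsSolAtLevel (N α₀ : ℝ) (u : ℝ → ℝ) : Prop :=
  ContDiffOn ℝ 2 u (Ici 0) ∧
  (∀ r : ℝ, 0 < r →
    deriv (deriv u) r + deriv u r / r + (1 + r ^ 2) ^ N * Real.exp (2 * u r) = 0) ∧
  derivWithin u (Ici 0) 0 = 0 ∧
  IntegrableOn (fun r => (1 + r ^ 2) ^ N * Real.exp (2 * u r) * r) (Ioi 0) ∧
  (∫ r in Ioi (0:ℝ), (1 + r ^ 2) ^ N * Real.exp (2 * u r) * r) = α₀

open scoped Topology

/-- The density `r² (1 + r²)^N e^{2u}` in the logarithmic variable `t = log r`,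
with `U t = u (exp t)`. -/
def logDensity (N : ℝ) (U : ℝ → ℝ) (t : ℝ) : ℝ :=
  exp (2 * U t) * (exp (2 * t) * (1 + exp (2 * t)) ^ N)

/-- The weight `r² / (1 + r²)` in the logarithmic variable `t = log r`. -/
def logWeight (t : ℝ) : ℝ := exp (2 * t) / (1 + exp (2 * t))

/-- The Pohozaev function of a profile `U` with mass function `m`. -/
def pohozaev (N : ℝ) (U m : ℝ → ℝ) (t : ℝ) : ℝ := logDensity N U t + m t ^ 2 - 2 * m t

/-- The Liouville equation in the logarithmic variable `t = log r`, where `m t` is the mass of the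
ball of radius `exp t`, `a` is the value at the origin and `α` is the total mass. -/
structure IsLogProfile (N a α : ℝ) (U m : ℝ → ℝ) : Prop where
  hasDerivAt_profile : ∀ t, HasDerivAt U (-m t) t
  hasDerivAt_mass : ∀ t, HasDerivAt m (logDensity N U t) t
  tendsto_profile : Tendsto U atBot (𝓝 a)
  tendsto_exp_mul_mass : Tendsto (fun t => exp (-t) * m t) atBot (𝓝 0)
  tendsto_mass : Tendsto m atTop (𝓝 α)

theorem strictMonoOn_of_forall_hasDerivAt_pos {D : Set ℝ} (hD : Convex ℝ D) {f f' : ℝ → ℝ}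
    (hf : ∀ x, HasDerivAt f (f' x) x) (hpos : ∀ x ∈ interior D, 0 < f' x) : StrictMonoOn f D :=
  strictMonoOn_of_deriv_pos hD (fun x _ => (hf x).continuousAt.continuousWithinAt)
    fun x hx => by rw [(hf x).deriv]; exact hpos x hx

theorem strictAntiOn_of_forall_hasDerivAt_neg {D : Set ℝ} (hD : Convex ℝ D) {f f' : ℝ → ℝ}
    (hf : ∀ x, HasDerivAt f (f' x) x) (hneg : ∀ x ∈ interior D, f' x < 0) : StrictAntiOn f D :=
  strictAntiOn_of_deriv_neg hD (fun x _ => (hf x).continuousAt.continuousWithinAt)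
    fun x hx => by rw [(hf x).deriv]; exact hneg x hx

theorem monotone_of_forall_hasDerivAt_nonneg {f f' : ℝ → ℝ}
    (hf : ∀ x, HasDerivAt f (f' x) x) (hpos : ∀ x, 0 ≤ f' x) : Monotone f :=
  monotone_of_deriv_nonneg (fun x => (hf x).differentiableAt)
    fun x => by rw [(hf x).deriv]; exact hpos x

theorem StrictMono.lt_of_tendsto_atBot {f : ℝ → ℝ} {l : ℝ} (hf : StrictMono f)
    (hl : Tendsto f atBot (𝓝 l)) (t : ℝ) : l < f t :=
  (hf.monotone.le_of_tendsto hl (t - 1)).trans_lt (hf (by linarith))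

theorem StrictMono.lt_of_tendsto_atTop {f : ℝ → ℝ} {l : ℝ} (hf : StrictMono f)
    (hl : Tendsto f atTop (𝓝 l)) (t : ℝ) : f t < l :=
  (hf (by linarith : t < t + 1)).trans_le (hf.monotone.ge_of_tendsto hl (t + 1))

theorem logDensity_pos (N : ℝ) (U : ℝ → ℝ) (t : ℝ) : 0 < logDensity N U t := by
  unfold logDensity; positivity

theorem logWeight_pos (t : ℝ) : 0 < logWeight t := by
  unfold logWeight; positivity

theorem one_sub_logWeight (t : ℝ) : 1 - logWeight t = 1 / (1 + exp (2 * t)) := by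
  have : 1 + exp (2 * t) ≠ 0 := by positivity
  unfold logWeight; field_simp; ring

theorem logWeight_lt_one (t : ℝ) : logWeight t < 1 := by
  have h : 0 < 1 / (1 + exp (2 * t)) := by positivity
  linarith [one_sub_logWeight t]

theorem logWeight_le_exp (t : ℝ) : logWeight t ≤ exp (2 * t) :=
  div_le_self (exp_pos _).le (by linarith [exp_pos (2 * t)])

theorem logWeight_strictMono : StrictMono logWeight := by
  intro s t hst
  have h : exp (2 * s) < exp (2 * t) := exp_lt_exp.2 (by linarith)
  have : 1 / (1 + exp (2 * t)) < 1 / (1 + exp (2 * s)) :=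
    one_div_lt_one_div_of_lt (by positivity) (by linarith)
  linarith [one_sub_logWeight s, one_sub_logWeight t]

theorem hasDerivAt_exp_two_mul (t : ℝ) :
    HasDerivAt (fun t : ℝ => exp (2 * t)) (2 * exp (2 * t)) t := by
  simpa [mul_comm] using ((hasDerivAt_id t).const_mul 2).exp

namespace IsLogProfile

variable {N a α : ℝ} {U m : ℝ → ℝ}

theorem hasDerivAt_logDensity (h : IsLogProfile N a α U m) (t : ℝ) :
    HasDerivAt (logDensity N U)
      (logDensity N U t * (2 + 2 * N * logWeight t - 2 * m t)) t := by
  have hpos : 0 < 1 + exp (2 * t) := by positivity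
  have h1 : HasDerivAt (fun t => exp (2 * U t)) (exp (2 * U t) * (2 * -m t)) t :=
    ((h.hasDerivAt_profile t).const_mul 2).exp
  have h2 : HasDerivAt (fun t : ℝ => (1 + exp (2 * t)) ^ N)
      (2 * exp (2 * t) * N * (1 + exp (2 * t)) ^ (N - 1)) t :=
    ((hasDerivAt_exp_two_mul t).const_add 1).rpow_const (Or.inl hpos.ne')
  refine (h1.mul ((hasDerivAt_exp_two_mul t).mul h2)).congr_deriv ?_
  rw [rpow_sub_one hpos.ne', Pi.mul_apply]
  unfold logDensity logWeight
  field_simp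
  ring

theorem tendsto_mass_atBot (h : IsLogProfile N a α U m) : Tendsto m atBot (𝓝 0) := by
  have := h.tendsto_exp_mul_mass.mul tendsto_exp_atBot
  simp only [mul_zero] at this
  refine this.congr fun t => ?_
  rw [mul_right_comm, ← exp_add]
  simp

theorem tendsto_exp_two_mul_atBot : Tendsto (fun t : ℝ => exp (2 * t)) atBot (𝓝 0) :=
  tendsto_exp_atBot.comp (tendsto_id.const_mul_atBot two_pos)

theorem tendsto_logDensity_atBot (h : IsLogProfile N a α U m) :
    Tendsto (logDensity N U) atBot (𝓝 0) := by
  have h1 : Tendsto (fun t => exp (2 * U t)) atBot (𝓝 (exp (2 * a))) :=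
    (continuous_exp.tendsto _).comp (h.tendsto_profile.const_mul 2)
  have h2 : Tendsto (fun t : ℝ => (1 + exp (2 * t)) ^ N) atBot (𝓝 ((1 + 0) ^ N)) :=
    (tendsto_exp_two_mul_atBot.const_add 1).rpow_const (by norm_num)
  unfold logDensity
  simpa using h1.mul (tendsto_exp_two_mul_atBot.mul h2)

theorem strictMono_mass (h : IsLogProfile N a α U m) : StrictMono m :=
  strictMono_of_hasDerivAt_pos h.hasDerivAt_mass (logDensity_pos N U)

theorem mass_pos (h : IsLogProfile N a α U m) (t : ℝ) : 0 < m t :=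
  h.strictMono_mass.lt_of_tendsto_atBot h.tendsto_mass_atBot t

theorem mass_lt (h : IsLogProfile N a α U m) (t : ℝ) : m t < α :=
  h.strictMono_mass.lt_of_tendsto_atTop h.tendsto_mass t

theorem total_pos (h : IsLogProfile N a α U m) : 0 < α := (h.mass_pos 0).trans (h.mass_lt 0)

theorem profile_le (h : IsLogProfile N a α U m) (t : ℝ) : U t ≤ a := by
  have hanti : Monotone (fun t => -U t) :=
    monotone_of_forall_hasDerivAt_nonneg (fun x => (h.hasDerivAt_profile x).neg)
      fun x => by simpa using (h.mass_pos x).le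
  linarith [hanti.le_of_tendsto h.tendsto_profile.neg t]

theorem hasDerivAt_pohozaev (h : IsLogProfile N a α U m) (t : ℝ) :
    HasDerivAt (pohozaev N U m) (2 * N * logWeight t * logDensity N U t) t := by
  refine (((h.hasDerivAt_logDensity t).add ((h.hasDerivAt_mass t).pow 2)).sub
    ((h.hasDerivAt_mass t).const_mul 2)).congr_deriv ?_
  push_cast
  ring

theorem tendsto_pohozaev_atBot (h : IsLogProfile N a α U m) :
    Tendsto (pohozaev N U m) atBot (𝓝 0) := by
  unfold pohozaev
  simpa using (h.tendsto_logDensity_atBot.add (h.tendsto_mass_atBot.pow 2)).sub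
    (h.tendsto_mass_atBot.const_mul 2)

theorem strictMono_pohozaev (h : IsLogProfile N a α U m) (hN : 0 < N) :
    StrictMono (pohozaev N U m) :=
  strictMono_of_hasDerivAt_pos h.hasDerivAt_pohozaev fun t => by
    have := logDensity_pos N U t
    have := logWeight_pos t
    positivity

theorem pohozaev_pos (h : IsLogProfile N a α U m) (hN : 0 < N) (t : ℝ) : 0 < pohozaev N U m t :=
  (h.strictMono_pohozaev hN).lt_of_tendsto_atBot h.tendsto_pohozaev_atBot t

theorem hasDerivAt_mass_sub_pohozaev (h : IsLogProfile N a α U m) (t : ℝ) :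
    HasDerivAt (fun t => 2 * N * m t - pohozaev N U m t)
      (2 * N * (1 - logWeight t) * logDensity N U t) t :=
  (((h.hasDerivAt_mass t).const_mul (2 * N)).sub (h.hasDerivAt_pohozaev t)).congr_deriv (by ring)

theorem strictMono_mass_sub_pohozaev (h : IsLogProfile N a α U m) (hN : 0 < N) :
    StrictMono fun t => 2 * N * m t - pohozaev N U m t :=
  strictMono_of_hasDerivAt_pos h.hasDerivAt_mass_sub_pohozaev fun t => by
    have := logDensity_pos N U t
    have := sub_pos.2 (logWeight_lt_one t)
    positivity

theorem tendsto_mass_sub_pohozaev_atBot (h : IsLogProfile N a α U m) :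
    Tendsto (fun t => 2 * N * m t - pohozaev N U m t) atBot (𝓝 0) := by
  simpa using (h.tendsto_mass_atBot.const_mul (2 * N)).sub h.tendsto_pohozaev_atBot

theorem pohozaev_lt (h : IsLogProfile N a α U m) (hN : 0 < N) (t : ℝ) :
    pohozaev N U m t < 2 * N * m t :=
  sub_pos.1 ((h.strictMono_mass_sub_pohozaev hN).lt_of_tendsto_atBot
    h.tendsto_mass_sub_pohozaev_atBot t)

theorem pohozaev_le_exp_mul_mass (h : IsLogProfile N a α U m) (hN : 0 < N) (t : ℝ) :
    pohozaev N U m t ≤ 2 * N * (exp (2 * t) * m t) := by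
  have hmono : Monotone fun t => 2 * N * (exp (2 * t) * m t) - pohozaev N U m t := by
    refine monotone_of_forall_hasDerivAt_nonneg (fun t =>
      (((hasDerivAt_exp_two_mul t).mul (h.hasDerivAt_mass t)).const_mul (2 * N)).sub
        (h.hasDerivAt_pohozaev t)) fun t => ?_
    have h1 := logDensity_pos N U t
    have h2 := sub_nonneg.2 (logWeight_le_exp t)
    have h3 := h.mass_pos t
    have : 0 ≤ 2 * N * (2 * exp (2 * t) * m t)
        + 2 * N * (logDensity N U t * (exp (2 * t) - logWeight t)) := by positivity
    linarith
  have hlim := ((tendsto_exp_two_mul_atBot.mul h.tendsto_mass_atBot).const_mul (2 * N)).sub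
    h.tendsto_pohozaev_atBot
  simp only [mul_zero, sub_zero] at hlim
  exact sub_nonneg.1 (hmono.le_of_tendsto hlim t)

theorem tendsto_logDensity_atTop (h : IsLogProfile N a α U m) (hN : 0 < N) :
    Tendsto (logDensity N U) atTop (𝓝 0) := by
  have hF : Tendsto (pohozaev N U m) atTop (𝓝 (⨆ t, pohozaev N U m t)) := by
    refine tendsto_atTop_ciSup (h.strictMono_pohozaev hN).monotone ⟨2 * N * α, ?_⟩
    rintro _ ⟨t, rfl⟩
    exact (h.pohozaev_lt hN t).le.trans
      (mul_le_mul_of_nonneg_left (h.mass_lt t).le (by positivity))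
  set L := ⨆ t, pohozaev N U m t
  have hq : Tendsto (logDensity N U) atTop (𝓝 (L - α ^ 2 + 2 * α)) := by
    refine ((hF.sub (h.tendsto_mass.pow 2)).add (h.tendsto_mass.const_mul 2)).congr fun t => ?_
    unfold pohozaev
    ring
  have hnonneg : 0 ≤ L - α ^ 2 + 2 * α :=
    ge_of_tendsto' hq fun t => (logDensity_pos N U t).le
  rcases hnonneg.eq_or_lt with h0 | hpos
  · rwa [← h0] at hq
  exfalso
  set l := L - α ^ 2 + 2 * α
  obtain ⟨T, hT⟩ := eventually_atTop.1 (hq.eventually (lt_mem_nhds (half_lt_self hpos)))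
  have hmono : StrictMonoOn (fun t => m t - l / 2 * t) (Ici T) :=
    strictMonoOn_of_forall_hasDerivAt_pos (convex_Ici T)
      (fun t => (h.hasDerivAt_mass t).sub ((hasDerivAt_id t).const_mul (l / 2))) fun t ht => by
        rw [interior_Ici] at ht
        simpa using hT t ht.le
  have hα := h.total_pos
  have hlt : T < T + 2 * α / l := by
    have : 0 < 2 * α / l := by positivity
    linarith
  have h1 := hmono self_mem_Ici hlt.le hlt
  have h2 : l / 2 * (T + 2 * α / l) = l / 2 * T + α := by field_simp
  simp only [h2] at h1
  linarith [h.mass_lt (T + 2 * α / l), h.mass_pos T]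

theorem tendsto_pohozaev_atTop (h : IsLogProfile N a α U m) (hN : 0 < N) :
    Tendsto (pohozaev N U m) atTop (𝓝 (α ^ 2 - 2 * α)) := by
  unfold pohozaev
  simpa using ((h.tendsto_logDensity_atTop hN).add (h.tendsto_mass.pow 2)).sub
    (h.tendsto_mass.const_mul 2)

theorem tendsto_mass_sub_pohozaev_atTop (h : IsLogProfile N a α U m) (hN : 0 < N) :
    Tendsto (fun t => 2 * N * m t - pohozaev N U m t) atTop
      (𝓝 (2 * N * α - (α ^ 2 - 2 * α))) :=
  (h.tendsto_mass.const_mul _).sub (h.tendsto_pohozaev_atTop hN)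

theorem two_lt_total (h : IsLogProfile N a α U m) (hN : 0 < N) : 2 < α := by
  have h1 := (h.pohozaev_pos hN 0).trans
    ((h.strictMono_pohozaev hN).lt_of_tendsto_atTop (h.tendsto_pohozaev_atTop hN) 0)
  nlinarith [h.total_pos]

theorem pohozaev_total_sub_lt (h : IsLogProfile N a α U m) (hN : 0 < N) (t : ℝ) :
    α ^ 2 - 2 * α - pohozaev N U m t < 2 * N * (α - m t) := by
  linarith [(h.strictMono_mass_sub_pohozaev hN).lt_of_tendsto_atTop
    (h.tendsto_mass_sub_pohozaev_atTop hN) t]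

theorem total_lt (h : IsLogProfile N a α U m) (hN : 0 < N) : α < 2 * (N + 1) := by
  have h1 := h.pohozaev_total_sub_lt hN 0
  have h2 := h.pohozaev_lt hN 0
  nlinarith [h.total_pos]

end IsLogProfile

theorem exists_first_zero {f : ℝ → ℝ} (hf : Continuous f) {s t : ℝ} (hs : f s < 0) (hst : s ≤ t)
    (ht : 0 ≤ f t) : ∃ r, s < r ∧ f r = 0 ∧ ∀ x, s ≤ x → x < r → f x < 0 := by
  set S := {x | 0 ≤ f x} ∩ Icc s t
  have hcpt : IsCompact S :=
    isCompact_Icc.inter_left (isClosed_le continuous_const hf)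
  obtain ⟨r, ⟨hr0, hrI⟩, hr⟩ := hcpt.exists_isLeast ⟨t, ht, hst, le_rfl⟩
  have hlt : ∀ x, s ≤ x → x < r → f x < 0 := fun x hx hxr =>
    lt_of_not_ge fun h0 => (hr ⟨h0, hx, hxr.le.trans hrI.2⟩).not_gt hxr
  have hsr : s < r := lt_of_le_of_ne hrI.1 fun h => (h ▸ hs).not_ge hr0
  refine ⟨r, hsr, le_antisymm ?_ hr0, hlt⟩
  refine le_of_tendsto (hf.continuousAt.tendsto.mono_left nhdsWithin_le_nhds :
    Tendsto f (𝓝[<] r) (𝓝 (f r))) ?_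
  filter_upwards [Ioo_mem_nhdsLT hsr] with x hx using (hlt x hx.1.le hx.2).le

namespace IsLogProfile

variable {N a b α β : ℝ} {U V m n : ℝ → ℝ}

theorem logDensity_eq_exp_mul (N : ℝ) (U V : ℝ → ℝ) (t : ℝ) :
    logDensity N V t = exp (2 * (V t - U t)) * logDensity N U t := by
  unfold logDensity
  rw [← mul_assoc (exp (2 * (V t - U t))), ← exp_add (2 * (V t - U t))]
  congr 2
  ring

theorem logDensity_lt (N : ℝ) {t : ℝ} (h : U t < V t) : logDensity N U t < logDensity N V t := by
  rw [logDensity_eq_exp_mul N U V]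
  have : 1 < exp (2 * (V t - U t)) := one_lt_exp_iff.2 (by linarith)
  nlinarith [logDensity_pos N U t]

theorem continuous_profile (h : IsLogProfile N a α U m) : Continuous U :=
  continuous_iff_continuousAt.2 fun t => (h.hasDerivAt_profile t).continuousAt

theorem continuous_mass (h : IsLogProfile N a α U m) : Continuous m :=
  continuous_iff_continuousAt.2 fun t => (h.hasDerivAt_mass t).continuousAt

theorem hasDerivAt_profile_sub (h : IsLogProfile N a α U m) (k : IsLogProfile N b β V n) (t : ℝ) :
    HasDerivAt (fun t => V t - U t) (m t - n t) t :=
  ((k.hasDerivAt_profile t).sub (h.hasDerivAt_profile t)).congr_deriv (by ring)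

theorem hasDerivAt_mass_sub (h : IsLogProfile N a α U m) (k : IsLogProfile N b β V n) (t : ℝ) :
    HasDerivAt (fun t => n t - m t) (logDensity N V t - logDensity N U t) t :=
  (k.hasDerivAt_mass t).sub (h.hasDerivAt_mass t)

theorem eventually_profile_lt (h : IsLogProfile N a α U m) (k : IsLogProfile N b β V n)
    (hab : a < b) : ∃ T, ∀ t ≤ T, U t < V t :=
  eventually_atBot.1 (h.tendsto_profile.eventually_lt k.tendsto_profile hab)

theorem mass_lt_mass (h : IsLogProfile N a α U m) (k : IsLogProfile N b β V n) {T : ℝ}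
    (hT : ∀ t < T, U t < V t) : m T < n T := by
  have hmono : StrictMonoOn (fun t => n t - m t) (Iic T) :=
    strictMonoOn_of_forall_hasDerivAt_pos (convex_Iic T) (hasDerivAt_mass_sub h k) fun t ht => by
      rw [interior_Iic] at ht
      exact sub_pos.2 (logDensity_lt N (hT t ht))
  have hlim : Tendsto (fun t => n t - m t) atBot (𝓝 0) := by
    simpa using k.tendsto_mass_atBot.sub h.tendsto_mass_atBot
  have h1 : 0 ≤ n (T - 1) - m (T - 1) := by
    refine le_of_tendsto hlim ?_
    filter_upwards [eventually_le_atBot (T - 1)] with t ht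
    exact hmono.monotoneOn (by simp only [mem_Iic]; linarith) (by simp) ht
  have h2 := hmono (show T - 1 ∈ Iic T by simp) self_mem_Iic (sub_one_lt T)
  simp only at h2
  linarith

/-- The difference of the Pohozaev functions, corrected by a multiple of the mass difference. -/
def pohozaevGap (N c : ℝ) (U m V n : ℝ → ℝ) (t : ℝ) : ℝ :=
  pohozaev N V n t - pohozaev N U m t - 2 * N * c * (n t - m t)

theorem hasDerivAt_pohozaevGap (h : IsLogProfile N a α U m) (k : IsLogProfile N b β V n)
    (c t : ℝ) : HasDerivAt (pohozaevGap N c U m V n)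
      (2 * N * ((logWeight t - c) * (logDensity N V t - logDensity N U t))) t :=
  (((k.hasDerivAt_pohozaev t).sub (h.hasDerivAt_pohozaev t)).sub
    ((hasDerivAt_mass_sub h k t).const_mul (2 * N * c))).congr_deriv (by ring)

theorem pohozaevGap_eq (N c : ℝ) (U m V n : ℝ → ℝ) (t : ℝ) :
    pohozaevGap N c U m V n t = logDensity N V t - logDensity N U t
      + (n t - m t) * (m t + n t - 2 - 2 * N * c) := by
  unfold pohozaevGap pohozaev
  ring

theorem tendsto_pohozaevGap_atBot (h : IsLogProfile N a α U m) (k : IsLogProfile N b β V n)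
    (c : ℝ) : Tendsto (pohozaevGap N c U m V n) atBot (𝓝 0) := by
  unfold pohozaevGap
  simpa using (k.tendsto_pohozaev_atBot.sub h.tendsto_pohozaev_atBot).sub
    ((k.tendsto_mass_atBot.sub h.tendsto_mass_atBot).const_mul (2 * N * c))

theorem tendsto_pohozaevGap_atTop (h : IsLogProfile N a α U m) (k : IsLogProfile N b β V n)
    (hN : 0 < N) (c : ℝ) : Tendsto (pohozaevGap N c U m V n) atTop
      (𝓝 ((β - α) * (α + β - 2 - 2 * N * c))) := by
  have := ((k.tendsto_pohozaev_atTop hN).sub (h.tendsto_pohozaev_atTop hN)).sub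
    ((k.tendsto_mass.sub h.tendsto_mass).const_mul (2 * N * c))
  have heq : (β - α) * (α + β - 2 - 2 * N * c)
      = β ^ 2 - 2 * β - (α ^ 2 - 2 * α) - 2 * N * c * (β - α) := by ring
  rw [heq]
  exact this

/-- If two profiles start at different heights, then the mass functions meet again. -/
theorem exists_mass_le (h : IsLogProfile N a α U m) (k : IsLogProfile N b β V n)
    (hN : 0 < N) (hN1 : N ≤ 1) (hab : a < b) : ∃ t, n t ≤ m t := by
  by_contra! hd
  have hanti : StrictAnti fun t => V t - U t :=
    strictAnti_of_hasDerivAt_neg (hasDerivAt_profile_sub h k) fun t => by linarith [hd t]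
  obtain ⟨T, hT⟩ := eventually_profile_lt h k hab
  obtain ⟨t₁, ht₁⟩ : ∃ t, V t ≤ U t := by
    by_contra! hw
    have hmono : StrictMono fun t => n t - m t :=
      strictMono_of_hasDerivAt_pos (hasDerivAt_mass_sub h k) fun t =>
        sub_pos.2 (logDensity_lt N (hw t))
    set δ := n 0 - m 0
    have hδ0 : 0 < δ := sub_pos.2 (hd 0)
    have hlin : StrictAntiOn (fun t => V t - U t + δ * t) (Ici 0) :=
      strictAntiOn_of_forall_hasDerivAt_neg (convex_Ici 0)
        (fun t => (hasDerivAt_profile_sub h k t).add ((hasDerivAt_id t).const_mul δ))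
        fun t ht => by
          rw [interior_Ici] at ht
          have := hmono (show (0 : ℝ) < t from ht)
          simp only at this
          linarith
    have hw0 := sub_pos.2 (hw 0)
    have hpos : 0 < (V 0 - U 0) / δ := by positivity
    have h1 := hlin self_mem_Ici hpos.le hpos
    simp only [mul_div_cancel₀ _ hδ0.ne'] at h1
    linarith [hw ((V 0 - U 0) / δ)]
  have hcont : Continuous fun t => U t - V t := h.continuous_profile.sub k.continuous_profile
  have hTt : T ≤ t₁ := le_of_not_gt fun hlt => (hT t₁ hlt.le).not_ge ht₁
  obtain ⟨t₀, -, ht₀, -⟩ := exists_first_zero hcont (sub_neg.2 (hT T le_rfl)) hTt (sub_nonneg.2 ht₁)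
  have hG : StrictAnti (pohozaevGap N (logWeight t₀) U m V n) := by
    have hder := hasDerivAt_pohozaevGap h k (logWeight t₀)
    refine StrictAntiOn.Iic_union_Ici (a := t₀)
      (strictAntiOn_of_forall_hasDerivAt_neg (convex_Iic t₀) hder fun t ht => ?_)
      (strictAntiOn_of_forall_hasDerivAt_neg (convex_Ici t₀) hder fun t ht => ?_)
    · rw [interior_Iic] at ht
      have h1 := hanti (show t < t₀ from ht)
      exact mul_neg_of_pos_of_neg (by positivity) (mul_neg_of_neg_of_pos
        (sub_neg.2 (logWeight_strictMono ht)) (sub_pos.2 (logDensity_lt N (by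
          simp only at h1; linarith))))
    · rw [interior_Ici] at ht
      have h1 := hanti (show t₀ < t from ht)
      exact mul_neg_of_pos_of_neg (by positivity) (mul_neg_of_pos_of_neg
        (sub_pos.2 (logWeight_strictMono ht)) (sub_neg.2 (logDensity_lt N (by
          simp only at h1; linarith))))
  have h0 := hG.antitone.ge_of_tendsto (tendsto_pohozaevGap_atBot h k _) 0
  have h1 := hG.antitone.le_of_tendsto (tendsto_pohozaevGap_atTop h k hN _) 1
  have h2 := hG one_pos
  have hαβ : α ≤ β := le_of_tendsto_of_tendsto' h.tendsto_mass k.tendsto_mass fun t => (hd t).le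
  have hρ := logWeight_lt_one t₀
  have hNρ : N * logWeight t₀ ≤ 1 := mul_le_one₀ hN1 (logWeight_pos t₀).le hρ.le
  nlinarith [h.two_lt_total hN, k.two_lt_total hN]

/-- A quantity which increases as long as the mass difference is positive; it vanishes
identically for solutions of the Liouville equation with constant weight. -/
def liouvilleGap (U m V n : ℝ → ℝ) (t : ℝ) : ℝ :=
  (n t - m t) * ((m t + n t) / 2 - 1) + (m t * (2 - m t) + n t * (2 - n t)) / 2 *
    ((exp (2 * (V t - U t)) - 1) / (exp (2 * (V t - U t)) + 1))

theorem hasDerivAt_liouvilleGap (h : IsLogProfile N a α U m) (k : IsLogProfile N b β V n) (t : ℝ) :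
    HasDerivAt (liouvilleGap U m V n)
      ((pohozaev N U m t + pohozaev N V n t) / 2 * (n t - m t) *
        (4 * exp (2 * (V t - U t)) / (exp (2 * (V t - U t)) + 1) ^ 2)) t := by
  have hE : HasDerivAt (fun t => exp (2 * (V t - U t)))
      (exp (2 * (V t - U t)) * (2 * (m t - n t))) t :=
    ((hasDerivAt_profile_sub h k t).const_mul 2).exp
  have hpos : exp (2 * (V t - U t)) + 1 ≠ 0 := by positivity
  have hm := h.hasDerivAt_mass t
  have hn := k.hasDerivAt_mass t
  refine (((hasDerivAt_mass_sub h k t).mul (((hm.add hn).div_const 2).sub_const 1)).add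
    ((((hm.mul (hm.const_sub 2)).add (hn.mul (hn.const_sub 2))).div_const 2).mul
      ((hE.sub_const 1).div (hE.add_const 1) hpos))).congr_deriv ?_
  simp only [Pi.mul_apply, Pi.add_apply, Pi.div_apply]
  unfold pohozaev
  rw [logDensity_eq_exp_mul N U V]
  generalize exp (2 * (V t - U t)) = E at *
  field_simp
  ring

theorem tendsto_liouvilleGap_atBot (h : IsLogProfile N a α U m) (k : IsLogProfile N b β V n) :
    Tendsto (liouvilleGap U m V n) atBot (𝓝 0) := by
  have hm := h.tendsto_mass_atBot
  have hn := k.tendsto_mass_atBot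
  have hE : Tendsto (fun t => exp (2 * (V t - U t))) atBot (𝓝 (exp (2 * (b - a)))) :=
    (continuous_exp.tendsto _).comp ((k.tendsto_profile.sub h.tendsto_profile).const_mul 2)
  unfold liouvilleGap
  simpa using ((hn.sub hm).mul (((hm.add hn).div_const 2).sub_const 1)).add
    ((((hm.mul (hm.const_sub 2)).add (hn.mul (hn.const_sub 2))).div_const 2).mul
      ((hE.sub_const 1).div (hE.add_const 1) (by positivity)))

/-- When the mass functions meet again, the common mass exceeds `2`. -/
theorem exists_mass_eq (h : IsLogProfile N a α U m) (k : IsLogProfile N b β V n)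
    (hN : 0 < N) (hN1 : N ≤ 1) (hab : a < b) : ∃ s, n s = m s ∧ V s < U s ∧ 2 < m s := by
  obtain ⟨T, hT⟩ := eventually_profile_lt h k hab
  obtain ⟨t₁, ht₁⟩ := exists_mass_le h k hN hN1 hab
  have hbot : ∀ t ≤ T, m t < n t := fun t ht =>
    mass_lt_mass h k fun x hx => hT x (hx.le.trans ht)
  have hTt : T ≤ t₁ := le_of_not_gt fun hlt => (hbot t₁ hlt.le).not_ge ht₁
  obtain ⟨s, -, hs0, hs⟩ := exists_first_zero (h.continuous_mass.sub k.continuous_mass)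
    (sub_neg.2 (hbot T le_rfl)) hTt (sub_nonneg.2 ht₁)
  have hpos : ∀ t < s, m t < n t := fun t ht =>
    (le_total t T).elim (hbot t) fun hle => sub_neg.1 (hs t hle ht)
  have hs1 : n s = m s := (sub_eq_zero.1 hs0).symm
  have hw : V s ≤ U s := by
    by_contra! hlt
    have hanti : StrictAntiOn (fun t => V t - U t) (Iic s) :=
      strictAntiOn_of_forall_hasDerivAt_neg (convex_Iic s) (hasDerivAt_profile_sub h k)
        fun t ht => by
          rw [interior_Iic] at ht
          linarith [hpos t ht]
    refine (mass_lt_mass h k (T := s) fun t ht => ?_).ne hs1.symm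
    have := hanti ht.le self_mem_Iic ht
    simp only at this
    linarith
  have hI : StrictMonoOn (liouvilleGap U m V n) (Iic s) :=
    strictMonoOn_of_forall_hasDerivAt_pos (convex_Iic s) (hasDerivAt_liouvilleGap h k)
      fun t ht => by
        rw [interior_Iic] at ht
        have h1 := h.pohozaev_pos hN t
        have h2 := k.pohozaev_pos hN t
        have h3 := sub_pos.2 (hpos t ht)
        positivity
  have hI1 : 0 ≤ liouvilleGap U m V n (s - 1) := by
    refine le_of_tendsto (tendsto_liouvilleGap_atBot h k) ?_
    filter_upwards [eventually_le_atBot (s - 1)] with t ht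
    exact hI.monotoneOn (by simp only [mem_Iic]; linarith) (by simp) ht
  have hI2 := hI1.trans_lt (hI (show s - 1 ∈ Iic s by simp) self_mem_Iic (sub_one_lt s))
  unfold liouvilleGap at hI2
  rw [hs1, sub_self, zero_mul, zero_add] at hI2
  set E := exp (2 * (V s - U s)) with hE
  have hE1 : E ≤ 1 := exp_le_one_iff.2 (by linarith)
  have hth : (E - 1) / (E + 1) ≤ 0 :=
    div_nonpos_of_nonpos_of_nonneg (by linarith) (by positivity)
  refine ⟨s, hs1, lt_of_le_of_ne hw fun heq => ?_, ?_⟩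
  · rw [hE, heq] at hI2
    simp at hI2
  · by_contra! hm
    have := mul_nonneg (h.mass_pos s).le (sub_nonneg.2 hm)
    nlinarith

/-- Profiles starting higher have smaller total mass. -/
theorem total_lt_total (h : IsLogProfile N a α U m) (k : IsLogProfile N b β V n)
    (hN : 0 < N) (hN1 : N ≤ 1) (hab : a < b) : β < α := by
  obtain ⟨s, hs, hws, hms⟩ := exists_mass_eq h k hN hN1 hab
  have hd := hasDerivAt_mass_sub h k
  have hw := hasDerivAt_profile_sub h k
  by_cases hneg : ∀ t, s ≤ t → V t < U t
  · have hanti : StrictAntiOn (fun t => n t - m t) (Ici s) :=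
      strictAntiOn_of_forall_hasDerivAt_neg (convex_Ici s) hd fun t ht => by
        rw [interior_Ici] at ht
        exact sub_neg.2 (logDensity_lt N (hneg t (le_of_lt ht)))
    have h1 := hanti self_mem_Ici (show s + 1 ∈ Ici s by simp) (lt_add_one s)
    have h2 : β - α ≤ n (s + 1) - m (s + 1) := by
      refine le_of_tendsto (k.tendsto_mass.sub h.tendsto_mass) ?_
      filter_upwards [eventually_ge_atTop (s + 1)] with t ht
      exact hanti.antitoneOn (by simp) (by simp only [mem_Ici]; linarith) ht
    simp only at h1
    linarith
  push Not at hneg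
  obtain ⟨t₁, hst, ht₁⟩ := hneg
  obtain ⟨r, hsr, hr0, hr⟩ := exists_first_zero (k.continuous_profile.sub h.continuous_profile)
    (sub_neg.2 hws) hst (sub_nonneg.2 ht₁)
  rw [Pi.sub_apply] at hr0
  have hdr : n r - m r < 0 := by
    have hanti : StrictAntiOn (fun t => n t - m t) (Icc s r) :=
      strictAntiOn_of_forall_hasDerivAt_neg (convex_Icc s r) hd fun t ht => by
        rw [interior_Icc] at ht
        exact sub_neg.2 (logDensity_lt N (sub_neg.1 (hr t ht.1.le ht.2)))
    have := hanti (left_mem_Icc.2 hsr.le) (right_mem_Icc.2 hsr.le) hsr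
    simp only at this
    linarith
  have hqr : logDensity N V r = logDensity N U r := by
    rw [logDensity_eq_exp_mul N U V, hr0]
    simp
  have hGr : pohozaevGap N 1 U m V n r < 0 := by
    rw [pohozaevGap_eq, hqr]
    have h1 := h.strictMono_mass hsr
    have h2 := k.strictMono_mass hsr
    nlinarith
  have hG : ∀ D : Set ℝ, Convex ℝ D → (∀ t ∈ interior D, U t < V t) →
      StrictAntiOn (pohozaevGap N 1 U m V n) D := fun D hD hUV =>
    strictAntiOn_of_forall_hasDerivAt_neg hD (hasDerivAt_pohozaevGap h k 1) fun t ht =>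
      mul_neg_of_pos_of_neg (by positivity) (mul_neg_of_neg_of_pos
        (sub_neg.2 (logWeight_lt_one t)) (sub_pos.2 (logDensity_lt N (hUV t ht))))
  have hw_pos : ∀ y, (∀ t, r ≤ t → t < y → n t - m t < 0) → ∀ t, r < t → t ≤ y → U t < V t := by
    intro y hy t hrt hty
    have hmono : StrictMonoOn (fun t => V t - U t) (Icc r t) :=
      strictMonoOn_of_forall_hasDerivAt_pos (convex_Icc r t) hw fun x hx => by
        rw [interior_Icc] at hx
        linarith [hy x hx.1.le (hx.2.trans_le hty)]
    have := hmono (left_mem_Icc.2 hrt.le) (right_mem_Icc.2 hrt.le) hrt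
    simp only at this
    linarith [hr0.ge]
  have hd_neg : ∀ t, r ≤ t → n t - m t < 0 := by
    by_contra! hex
    obtain ⟨t₂, hrt, ht₂⟩ := hex
    obtain ⟨y, hry, hy0, hy⟩ := exists_first_zero (k.continuous_mass.sub h.continuous_mass)
      hdr hrt ht₂
    rw [Pi.sub_apply] at hy0
    have hpos := hw_pos y hy
    have h1 := hG (Icc r y) (convex_Icc r y) (fun t ht => by
      rw [interior_Icc] at ht
      exact hpos t ht.1 ht.2.le) (left_mem_Icc.2 hry.le) (right_mem_Icc.2 hry.le) hry
    rw [pohozaevGap_eq N 1 U m V n y, hy0] at h1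
    linarith [logDensity_lt N (hpos y hry le_rfl)]
  have hanti := hG (Ici r) (convex_Ici r) fun t ht => by
    rw [interior_Ici] at ht
    exact hw_pos t (fun x hx _ => hd_neg x hx) t ht le_rfl
  have hlim : (β - α) * (α + β - 2 - 2 * N * 1) ≤ pohozaevGap N 1 U m V n r := by
    refine le_of_tendsto (tendsto_pohozaevGap_atTop h k hN 1) ?_
    filter_upwards [eventually_ge_atTop r] with t ht
    exact hanti.antitoneOn self_mem_Ici ht ht
  by_contra! hle
  have : 0 ≤ (β - α) * (α + β - 2 - 2 * N * 1) :=
    mul_nonneg (by linarith) (by linarith [h.two_lt_total hN, k.two_lt_total hN])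
  linarith

end IsLogProfile

theorem abs_exp_sub_exp_le {x y B : ℝ} (hx : x ≤ B) (hy : y ≤ B) :
    |exp x - exp y| ≤ exp B * |x - y| := by
  wlog hxy : y ≤ x generalizing x y
  · rw [abs_sub_comm (exp x), abs_sub_comm x]
    exact this hy hx (le_of_not_ge hxy)
  rw [abs_of_nonneg (sub_nonneg.2 (exp_le_exp.2 hxy)), abs_of_nonneg (sub_nonneg.2 hxy)]
  have h1 : exp y = exp x * exp (y - x) := by rw [← exp_add]; ring_nf
  have h2 := add_one_le_exp (y - x)
  have h3 := exp_le_exp.2 hx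
  calc exp x - exp y = exp x * (1 - exp (y - x)) := by rw [h1]; ring
    _ ≤ exp x * (x - y) := mul_le_mul_of_nonneg_left (by linarith) (exp_pos x).le
    _ ≤ exp B * (x - y) := mul_le_mul_of_nonneg_right h3 (sub_nonneg.2 hxy)

namespace IsLogProfile

variable {N a b α β : ℝ} {U V m n : ℝ → ℝ}

/-- Continuous dependence of the solution on its value at the origin. -/
theorem energy_le (h : IsLogProfile N a α U m) (k : IsLogProfile N b β V n) (hN : 0 < N)
    {A : ℝ} (haA : a ≤ A) (hbA : b ≤ A) (T : ℝ) :
    (V T - U T) ^ 2 + (exp (-T) * (n T - m T)) ^ 2 ≤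
      (b - a) ^ 2 * exp ((1 + 2 * (1 + exp (2 * T)) ^ N * exp (2 * A)) * exp T) := by
  set K := (1 + exp (2 * T)) ^ N
  set C := 1 + 2 * K * exp (2 * A) with hC
  have hK0 : 0 < K := by positivity
  set E := fun t => (V t - U t) ^ 2 + (exp (-t) * (n t - m t)) ^ 2
  have hderE : ∀ t, HasDerivAt E (-2 * (V t - U t) * (n t - m t) + 2 * (exp (-t) * (n t - m t)) *
      (exp (-t) * (logDensity N V t - logDensity N U t) - exp (-t) * (n t - m t))) t := fun t => by
    refine (((hasDerivAt_profile_sub h k t).pow 2).add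
      (((hasDerivAt_neg t).exp.mul (hasDerivAt_mass_sub h k t)).pow 2)).congr_deriv ?_
    simp only [Pi.mul_apply]
    push_cast
    ring
  have hder : ∀ t, HasDerivAt (fun t => E t * exp (-(C * exp t))) _ t := fun t =>
    (hderE t).mul (((hasDerivAt_exp t).const_mul C).neg.exp)
  have hanti : AntitoneOn (fun t => E t * exp (-(C * exp t))) (Iic T) := by
    refine antitoneOn_of_deriv_nonpos (convex_Iic T)
      (fun t _ => (hder t).continuousAt.continuousWithinAt)
      (fun t _ => (hder t).differentiableAt.differentiableWithinAt) fun t ht => ?_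
    rw [interior_Iic] at ht
    rw [(hder t).deriv]
    set w := V t - U t
    set δ := exp (-t) * (n t - m t) with hδ
    have hd : n t - m t = exp t * δ := by
      rw [hδ, ← mul_assoc, ← exp_add]
      simp
    have hq : exp (-t) * (logDensity N V t - logDensity N U t)
        = exp t * ((1 + exp (2 * t)) ^ N * (exp (2 * V t) - exp (2 * U t))) := by
      have : exp (2 * t) = exp t * exp t := by rw [← exp_add]; ring_nf
      have h1 : exp (-t) * exp t = 1 := by rw [← exp_add]; simp
      unfold logDensity
      linear_combination (1 + exp (2 * t)) ^ N * (exp (2 * V t) - exp (2 * U t)) *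
        (exp (-t) * this + exp t * h1)
    have hKt : (1 + exp (2 * t)) ^ N ≤ K := by
      have : exp (2 * t) ≤ exp (2 * T) := exp_le_exp.2 (by linarith [show t < T from ht])
      exact rpow_le_rpow (by positivity) (by linarith) hN.le
    have hKt0 : 0 < (1 + exp (2 * t)) ^ N := by positivity
    have hexp : |exp (2 * V t) - exp (2 * U t)| ≤ exp (2 * A) * (2 * |w|) := by
      refine (abs_exp_sub_exp_le (B := 2 * A) (by linarith [k.profile_le t])
        (by linarith [h.profile_le t])).trans_eq ?_
      rw [← mul_sub, abs_mul, abs_two]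
    have hX : |(1 + exp (2 * t)) ^ N * (exp (2 * V t) - exp (2 * U t))| ≤
        K * (exp (2 * A) * (2 * |w|)) := by
      rw [abs_mul, abs_of_pos hKt0]
      exact mul_le_mul hKt hexp (abs_nonneg _) hK0.le
    set X := (1 + exp (2 * t)) ^ N * (exp (2 * V t) - exp (2 * U t))
    have h1 : -2 * w * δ ≤ w ^ 2 + δ ^ 2 := by nlinarith [sq_nonneg (w + δ)]
    have h2 : 2 * δ * X ≤ 2 * K * exp (2 * A) * (w ^ 2 + δ ^ 2) := by
      have h3 : δ * X ≤ |δ| * (K * (exp (2 * A) * (2 * |w|))) :=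
        (le_abs_self _).trans ((abs_mul δ X).le.trans
          (mul_le_mul_of_nonneg_left hX (abs_nonneg _)))
      have h4 : 2 * |δ| * |w| ≤ w ^ 2 + δ ^ 2 := by
        nlinarith [sq_nonneg (|δ| - |w|), sq_abs δ, sq_abs w]
      have h5 := mul_le_mul_of_nonneg_left h4 (by positivity : 0 ≤ 2 * K * exp (2 * A))
      nlinarith
    have hEt : E t = w ^ 2 + δ ^ 2 := rfl
    rw [hq, hEt, hd, Pi.neg_apply]
    have h6 := mul_le_mul_of_nonneg_left (add_le_add h1 h2) (exp_pos t).le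
    have h7 := exp_pos (-(C * exp t))
    have h8 : -2 * w * (exp t * δ) + 2 * δ * (exp t * X - δ)
        - C * exp t * (w ^ 2 + δ ^ 2) ≤ 0 := by
      rw [hC]
      linarith [sq_nonneg δ]
    calc _ = (-2 * w * (exp t * δ) + 2 * δ * (exp t * X - δ)
          - C * exp t * (w ^ 2 + δ ^ 2)) * exp (-(C * exp t)) := by ring
      _ ≤ 0 := mul_nonpos_of_nonpos_of_nonneg h8 h7.le
  have hlim : Tendsto (fun t => E t * exp (-(C * exp t))) atBot (𝓝 ((b - a) ^ 2)) := by
    have h1 : Tendsto (fun t => exp (-t) * (n t - m t)) atBot (𝓝 0) := by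
      simpa [mul_sub] using k.tendsto_exp_mul_mass.sub h.tendsto_exp_mul_mass
    have h2 : Tendsto (fun t => exp (-(C * exp t))) atBot (𝓝 (exp (-(C * 0)))) :=
      (continuous_exp.tendsto _).comp (tendsto_exp_atBot.const_mul C).neg
    simpa using (((k.tendsto_profile.sub h.tendsto_profile).pow 2).add (h1.pow 2)).mul h2
  have hle : E T * exp (-(C * exp T)) ≤ (b - a) ^ 2 := by
    refine ge_of_tendsto hlim ?_
    filter_upwards [eventually_le_atBot T] with t ht
    exact hanti ht self_mem_Iic ht
  calc E T = E T * exp (-(C * exp T)) * exp (C * exp T) := by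
        rw [mul_assoc, ← exp_add]; simp
    _ ≤ _ := mul_le_mul_of_nonneg_right hle (exp_pos _).le

theorem profile_unique (h : IsLogProfile N a α U m) (k : IsLogProfile N a β V n) (hN : 0 < N) :
    U = V := by
  funext t
  have := energy_le h k hN le_rfl le_rfl t
  rw [sub_self, zero_pow two_ne_zero, zero_mul] at this
  nlinarith [sq_nonneg (V t - U t), sq_nonneg (exp (-t) * (n t - m t))]

theorem total_le_add (h : IsLogProfile N a α U m) (hN : 0 < N) (hN1 : N ≤ 1) {t δ : ℝ}
    (hδ : 0 < δ) (hm : 2 + δ ≤ m t) : α ≤ m t + logDensity N U t / (2 * δ) := by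
  have h1 := h.pohozaev_total_sub_lt hN t
  have h2 := h.mass_lt t
  unfold pohozaev at h1
  have h3 : (α - m t) * (2 * δ) ≤ logDensity N U t := by nlinarith
  have h4 : α - m t ≤ logDensity N U t / (2 * δ) := (le_div_iff₀ (by positivity)).2 h3
  linarith

theorem mass_le_exp (h : IsLogProfile N a α U m) (hN : 0 < N) (T : ℝ) :
    m T ≤ exp (2 * a) * ((1 + exp (2 * T)) ^ N * exp (2 * T)) := by
  set K := (1 + exp (2 * T)) ^ N
  have hder : ∀ t, HasDerivAt (fun t => exp (2 * a) * (K * exp (2 * t)) - m t)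
      (exp (2 * a) * (K * (2 * exp (2 * t))) - logDensity N U t) t := fun t =>
    (((hasDerivAt_exp_two_mul t).const_mul K).const_mul _).sub (h.hasDerivAt_mass t)
  have hmono : StrictMonoOn (fun t => exp (2 * a) * (K * exp (2 * t)) - m t) (Iic T) := by
    refine strictMonoOn_of_forall_hasDerivAt_pos (convex_Iic T) hder fun t ht => ?_
    rw [interior_Iic] at ht
    have hKt : (1 + exp (2 * t)) ^ N ≤ K := by
      have : exp (2 * t) ≤ exp (2 * T) := exp_le_exp.2 (by linarith [show t < T from ht])
      exact rpow_le_rpow (by positivity) (by linarith) hN.le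
    have hU : exp (2 * U t) ≤ exp (2 * a) := exp_le_exp.2 (by linarith [h.profile_le t])
    have h1 : logDensity N U t ≤ exp (2 * a) * (exp (2 * t) * K) := by
      unfold logDensity
      gcongr
    have : 0 < exp (2 * a) * (exp (2 * t) * K) := by positivity
    linarith
  have hlim := ((tendsto_exp_two_mul_atBot.const_mul K).const_mul (exp (2 * a))).sub
    h.tendsto_mass_atBot
  simp only [mul_zero, sub_zero] at hlim
  refine sub_nonneg.1 (le_of_tendsto hlim ?_)
  filter_upwards [eventually_le_atBot T] with t ht
  exact hmono.monotoneOn ht self_mem_Iic ht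

theorem le_total (h : IsLogProfile N a α U m) (hN : 0 < N) (hN1 : N ≤ 1) (T : ℝ) :
    2 * (N + 1) - m T - 2 * exp (-(2 * T)) ≤ α := by
  set ε := exp (-(2 * T)) with hε
  have hε0 : 0 < ε := exp_pos _
  have hanti : StrictAntiOn (fun t => 2 * N * m t - pohozaev N U m t - 2 * N * ε * m t)
      (Ici T) := by
    refine strictAntiOn_of_forall_hasDerivAt_neg (convex_Ici T) (fun t =>
      (h.hasDerivAt_mass_sub_pohozaev t).sub ((h.hasDerivAt_mass t).const_mul _)) fun t ht => ?_
    rw [interior_Ici] at ht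
    have h1 : 1 - logWeight t < ε := by
      rw [one_sub_logWeight, hε, exp_neg, one_div]
      refine inv_strictAnti₀ (exp_pos _) ?_
      linarith [exp_lt_exp.2 (show 2 * T < 2 * t by linarith [show T < t from ht])]
    have h2 := logDensity_pos N U t
    have h3 : 0 < 2 * N * ((ε - (1 - logWeight t)) * logDensity N U t) := by
      have := sub_pos.2 h1
      positivity
    linarith
  have hlim : 2 * N * α - (α ^ 2 - 2 * α) - 2 * N * ε * α ≤
      2 * N * m T - pohozaev N U m T - 2 * N * ε * m T := by
    refine le_of_tendsto ((h.tendsto_mass_sub_pohozaev_atTop hN).sub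
      (h.tendsto_mass.const_mul _)) ?_
    filter_upwards [eventually_ge_atTop T] with t ht
    exact hanti.antitoneOn self_mem_Ici ht ht
  have hF := h.pohozaev_pos hN T
  have hm := h.mass_pos T
  have hα := h.two_lt_total hN
  have h1 : 0 < 2 * N * ε * m T := by positivity
  have h2 : α * (2 * (N + 1) - α) ≤ 2 * N * m T + 2 * N * ε * α := by nlinarith
  have h3 : 2 * N * m T ≤ α * m T := by nlinarith
  have h4 : 2 * N * ε * α ≤ α * (2 * ε) := by
    nlinarith [mul_pos hε0 (show 0 < α by linarith)]
  have h5 : 0 ≤ α * (m T + 2 * ε - (2 * (N + 1) - α)) := by nlinarith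
  linarith [nonneg_of_mul_nonneg_right h5 (by linarith : 0 < α)]

theorem two_sub_mass_le (h : IsLogProfile N a α U m) (hN : 0 < N) (t : ℝ) :
    2 - m t ≤ 2 * exp (U t - a) := by
  have hanti : StrictAnti fun t => (2 - m t) * exp (-U t) := by
    refine strictAnti_of_hasDerivAt_neg (fun t =>
      ((h.hasDerivAt_mass t).const_sub 2).mul (h.hasDerivAt_profile t).neg.exp) fun t => ?_
    have h1 := mul_pos (h.pohozaev_pos hN t) (exp_pos (-U t))
    unfold pohozaev at h1
    rw [Pi.neg_apply]
    linarith
  have hlim : Tendsto (fun t => (2 - m t) * exp (-U t)) atBot (𝓝 ((2 - 0) * exp (-a))) :=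
    (h.tendsto_mass_atBot.const_sub 2).mul
      ((continuous_exp.tendsto _).comp h.tendsto_profile.neg)
  have h1 := mul_le_mul_of_nonneg_right (hanti.antitone.ge_of_tendsto hlim t) (exp_pos (U t)).le
  rw [mul_assoc, mul_assoc, ← exp_add, ← exp_add, neg_add_cancel, exp_zero, mul_one, sub_zero,
    neg_add_eq_sub] at h1
  exact h1

theorem sq_total_sub_two_le (h : IsLogProfile N a α U m) (hN : 0 < N) (hN1 : N ≤ 1) {t : ℝ}
    (ht : t ≤ 0) : (α - 2) ^ 2 ≤ 12 * exp (-t) * exp (-a) + 8 * exp (2 * t) := by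
  have hα := h.total_lt hN
  have hm := h.mass_lt t
  have hm0 := h.mass_pos t
  have hF : pohozaev N U m t ≤ 8 * exp (2 * t) := by
    refine (h.pohozaev_le_exp_mul_mass hN t).trans ?_
    have h1 : N * m t ≤ 4 := by nlinarith
    nlinarith [exp_pos (2 * t)]
  have hexp : exp (2 * t) ≤ 1 := exp_le_one_iff.2 (by linarith)
  have hUt : exp (U t + t) ≤ 3 := by
    have h1 : logDensity N U t ≤ 9 := by
      unfold pohozaev at hF
      nlinarith [sq_nonneg (m t - 1)]
    have h2 : 1 ≤ (1 + exp (2 * t)) ^ N :=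
      one_le_rpow (by linarith [exp_pos (2 * t)]) hN.le
    have h3 : exp (U t + t) ^ 2 ≤ logDensity N U t := by
      have : exp (U t + t) ^ 2 = exp (2 * U t) * (exp (2 * t) * 1) := by
        rw [mul_one, ← exp_add, ← exp_nat_mul]
        push_cast
        ring_nf
      rw [this]
      unfold logDensity
      gcongr
    nlinarith [exp_pos (U t + t)]
  have hU : exp (U t - a) ≤ 3 * exp (-t) * exp (-a) := by
    have : exp (U t - a) = exp (U t + t) * exp (-t) * exp (-a) := by
      rw [← exp_add, ← exp_add]
      ring_nf
    rw [this]
    gcongr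
  have h1 := h.two_sub_mass_le hN t
  have h2 := h.pohozaev_total_sub_lt hN t
  nlinarith

section Family

variable {N : ℝ} {α : ℝ → ℝ} {U m : ℝ → ℝ → ℝ}

theorem tendsto_profile_mass_of_forall (h : ∀ a, IsLogProfile N a (α a) (U a) (m a)) (hN : 0 < N)
    (a t : ℝ) : Tendsto (fun b => U b t) (𝓝 a) (𝓝 (U a t)) ∧
      Tendsto (fun b => m b t) (𝓝 a) (𝓝 (m a t)) := by
  set C := exp ((1 + 2 * (1 + exp (2 * t)) ^ N * exp (2 * (a + 1))) * exp t)
  have hE : ∀ᶠ b in 𝓝 a, (U b t - U a t) ^ 2 + (exp (-t) * (m b t - m a t)) ^ 2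
      ≤ (b - a) ^ 2 * C := by
    filter_upwards [eventually_le_nhds (lt_add_one a)] with b hb
    exact energy_le (h a) (h b) hN (by linarith) hb t
  have hlim : Tendsto (fun b => √((b - a) ^ 2 * C)) (𝓝 a) (𝓝 0) :=
    (by fun_prop : Continuous fun b => √((b - a) ^ 2 * C)).tendsto' _ _ (by simp)
  have hU : Tendsto (fun b => U b t - U a t) (𝓝 a) (𝓝 0) := by
    refine squeeze_zero_norm' ?_ hlim
    filter_upwards [hE] with b hb
    exact abs_le_sqrt (by nlinarith [sq_nonneg (exp (-t) * (m b t - m a t))])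
  have hm : Tendsto (fun b => exp (-t) * (m b t - m a t)) (𝓝 a) (𝓝 0) := by
    refine squeeze_zero_norm' ?_ hlim
    filter_upwards [hE] with b hb
    exact abs_le_sqrt (by nlinarith [sq_nonneg (U b t - U a t)])
  refine ⟨tendsto_sub_nhds_zero_iff.1 hU, tendsto_sub_nhds_zero_iff.1 ?_⟩
  have := hm.const_mul (exp t)
  simp only [← mul_assoc, ← exp_add, add_neg_cancel, exp_zero, one_mul, mul_zero] at this
  exact this

theorem continuous_total (h : ∀ a, IsLogProfile N a (α a) (U a) (m a)) (hN : 0 < N)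
    (hN1 : N ≤ 1) : Continuous α := by
  refine continuous_iff_continuousAt.2 fun a => tendsto_order.2 ⟨fun c hc => ?_, fun c hc => ?_⟩
  · obtain ⟨t, ht⟩ := ((h a).tendsto_mass.eventually (lt_mem_nhds hc)).exists
    filter_upwards [(tendsto_profile_mass_of_forall h hN a t).2.eventually (lt_mem_nhds ht)]
      with b hb using hb.trans ((h b).mass_lt t)
  · have hα := (h a).two_lt_total hN
    set δ := (α a - 2) / 2 with hδ
    have hδ0 : 0 < δ := by linarith
    have hlim := (h a).tendsto_mass.add (((h a).tendsto_logDensity_atTop hN).div_const (2 * δ))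
    rw [zero_div, add_zero] at hlim
    obtain ⟨t, ht1, ht2⟩ := ((hlim.eventually (gt_mem_nhds hc)).and
      ((h a).tendsto_mass.eventually (lt_mem_nhds (show 2 + δ < α a by linarith)))).exists
    obtain ⟨hU, hm⟩ := tendsto_profile_mass_of_forall h hN a t
    have hq : Tendsto (fun b => logDensity N (U b) t) (𝓝 a) (𝓝 (logDensity N (U a) t)) :=
      ((continuous_exp.tendsto _).comp (hU.const_mul 2)).mul_const _
    filter_upwards [(hm.add (hq.div_const (2 * δ))).eventually (gt_mem_nhds ht1),
      hm.eventually (lt_mem_nhds ht2)] with b hb1 hb2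
    exact ((h b).total_le_add hN hN1 hδ0 hb2.le).trans_lt hb1

theorem exists_lt_total (h : ∀ a, IsLogProfile N a (α a) (U a) (m a)) (hN : 0 < N)
    (hN1 : N ≤ 1) {c : ℝ} (hc : c < 2 * (N + 1)) : ∃ a, c < α a := by
  set η := 2 * (N + 1) - c with hη
  have hη0 : 0 < η := sub_pos.2 hc
  have h1 : Tendsto (fun T : ℝ => 2 * exp (-(2 * T))) atTop (𝓝 0) := by
    simpa using (tendsto_exp_neg_atTop_nhds_zero.comp
      (tendsto_id.const_mul_atTop (two_pos : (0 : ℝ) < 2))).const_mul 2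
  obtain ⟨T, hT⟩ := (h1.eventually (gt_mem_nhds (half_pos hη0))).exists
  have h2 := tendsto_exp_two_mul_atBot.mul_const ((1 + exp (2 * T)) ^ N * exp (2 * T))
  rw [zero_mul] at h2
  obtain ⟨a, ha⟩ := (h2.eventually (gt_mem_nhds (half_pos hη0))).exists
  refine ⟨a, ?_⟩
  linarith [(h a).mass_le_exp hN T, (h a).le_total hN hN1 T]

theorem exists_total_lt (h : ∀ a, IsLogProfile N a (α a) (U a) (m a)) (hN : 0 < N)
    (hN1 : N ≤ 1) {c : ℝ} (hc : 2 < c) : ∃ a, α a < c := by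
  set η := (c - 2) ^ 2
  have hη0 : 0 < η := pow_pos (sub_pos.2 hc) 2
  have h1 := tendsto_exp_two_mul_atBot.const_mul 8
  rw [mul_zero] at h1
  obtain ⟨t, ht1, ht2⟩ := ((h1.eventually (gt_mem_nhds (half_pos hη0))).and
    (eventually_le_atBot 0)).exists
  have h2 := tendsto_exp_neg_atTop_nhds_zero.const_mul (12 * exp (-t))
  rw [mul_zero] at h2
  obtain ⟨a, ha⟩ := (h2.eventually (gt_mem_nhds (half_pos hη0))).exists
  refine ⟨a, ?_⟩
  have h3 : (α a - 2) ^ 2 < (c - 2) ^ 2 := by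
    linarith [(h a).sq_total_sub_two_le hN hN1 ht2]
  linarith [lt_of_pow_lt_pow_left₀ 2 (by linarith) h3]

end Family

end IsLogProfile

/-- A radial solution yields a profile in the logarithmic variable. -/
theorem IsSol.isLogProfile {N : ℝ} {u : ℝ → ℝ} (hu : IsSol N u) :
    IsLogProfile N (u 0) (∫ r in Ioi (0 : ℝ), (1 + r ^ 2) ^ N * exp (2 * u r) * r)
      (fun t => u (exp t)) (fun t => -(exp t * deriv u (exp t))) := by
  obtain ⟨hC, hode, hu0, hint⟩ := hu
  have hCr : ∀ r : ℝ, 0 < r → ContDiffAt ℝ 2 u r := fun r hr => hC.contDiffAt (Ici_mem_nhds hr)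
  have hu1 : ∀ r : ℝ, 0 < r → HasDerivAt u (deriv u r) r := fun r hr =>
    ((hCr r hr).differentiableAt two_ne_zero).hasDerivAt
  have hu2 : ∀ r : ℝ, 0 < r → HasDerivAt (deriv u) (deriv (deriv u) r) r := fun r hr =>
    (((hCr r hr).derivWithin (m := 1) (by norm_num)).differentiableAt one_ne_zero).hasDerivAt
  have hmass : ∀ r ∈ Ioi (0 : ℝ), HasDerivAt (fun r => -(r * deriv u r))
      ((1 + r ^ 2) ^ N * exp (2 * u r) * r) r := fun r hr => by
    have hr0 : r ≠ 0 := ne_of_gt hr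
    refine ((hasDerivAt_id r).mul (hu2 r hr)).neg.congr_deriv ?_
    have := hode r hr
    field_simp at this
    simp only [id_eq]
    linear_combination -this
  have hderiv : Tendsto (deriv u) (𝓝[>] 0) (𝓝 0) := by
    have h1 := (hC.continuousOn_derivWithin (uniqueDiffOn_Ici 0) (by norm_num)) 0 self_mem_Ici
    have h2 := h1.mono_left (nhdsWithin_mono 0 Ioi_subset_Ici_self)
    rw [hu0] at h2
    refine h2.congr' ?_
    filter_upwards [self_mem_nhdsWithin] with r hr
    exact derivWithin_of_mem_nhds (Ici_mem_nhds hr)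
  have hlim := tendsto_limUnder_of_hasDerivAt_of_integrableOn_Ioi hmass hint
  have hcont : ContinuousWithinAt (fun r => -(r * deriv u r)) (Ici 0) 0 := by
    rw [← Ioi_insert, continuousWithinAt_insert_self]
    have : Tendsto (fun r : ℝ => r) (𝓝[>] 0) (𝓝 0) := tendsto_id.mono_left nhdsWithin_le_nhds
    simpa [ContinuousWithinAt] using (this.mul hderiv).neg
  have htotal := integral_Ioi_of_hasDerivAt_of_tendsto hcont hmass hint hlim
  rw [zero_mul, neg_zero, sub_zero] at htotal
  refine ⟨fun t => ?_, fun t => ?_, ?_, ?_, ?_⟩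
  · refine ((hu1 _ (exp_pos t)).comp t (hasDerivAt_exp t)).congr_deriv ?_
    ring
  · refine ((hmass _ (exp_pos t)).comp t (hasDerivAt_exp t)).congr_deriv ?_
    have : exp (2 * t) = exp t ^ 2 := by rw [← exp_nat_mul]; norm_num
    unfold logDensity
    rw [this]
    ring
  · have h1 := (hC.continuousOn 0 self_mem_Ici).mono_left (nhdsWithin_mono 0 Ioi_subset_Ici_self)
    exact Tendsto.comp h1 tendsto_exp_atBot_nhdsGT
  · have h1 := (hderiv.comp tendsto_exp_atBot_nhdsGT).neg
    rw [neg_zero] at h1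
    refine h1.congr fun t => ?_
    rw [mul_neg, ← mul_assoc, ← exp_add]
    simp
  · rw [htotal]
    exact hlim.comp tendsto_exp_atTop

theorem IsSolAtLevel.isLogProfile {N α₀ : ℝ} {u : ℝ → ℝ} (hu : IsSolAtLevel N α₀ u) :
    IsLogProfile N (u 0) α₀ (fun t => u (exp t)) (fun t => -(exp t * deriv u (exp t))) := by
  obtain ⟨hC, hode, hu0, hint, rfl⟩ := hu
  exact IsSol.isLogProfile ⟨hC, hode, hu0, hint⟩

theorem IsSolAtLevel.eqOn {N α₀ : ℝ} (hN0 : 0 < N) (hN1 : N ≤ 1) {v w : ℝ → ℝ}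
    (hv : IsSolAtLevel N α₀ v) (hw : IsSolAtLevel N α₀ w) : EqOn v w (Ici 0) := by
  have h0 : v 0 = w 0 := by
    rcases lt_trichotomy (v 0) (w 0) with h | h | h
    · exact absurd (hv.isLogProfile.total_lt_total hw.isLogProfile hN0 hN1 h) (lt_irrefl _)
    · exact h
    · exact absurd (hw.isLogProfile.total_lt_total hv.isLogProfile hN0 hN1 h) (lt_irrefl _)
  have hwp := hw.isLogProfile
  rw [← h0] at hwp
  have heq := hv.isLogProfile.profile_unique hwp hN0
  intro r hr
  rcases (mem_Ici.1 hr).eq_or_lt with rfl | hpos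
  · exact h0
  · simpa [exp_log hpos] using congrFun heq (log r)

/-- For `0 < N ≤ 1`, `a ↦ α(a)` is strictly decreasing; a radial solution at level
`α₀` exists iff `α₀ ∈ (2, 2(N+1))`, and in that case it is unique. -/
theorem alpha_strictAnti_and_uniqueness (N : ℝ) (hN0 : 0 < N) (hN1 : N ≤ 1)
    (u : ℝ → ℝ → ℝ) (hu : ∀ a : ℝ, IsSol N (u a) ∧ u a 0 = a)
    (α : ℝ → ℝ)
    (hα : ∀ a : ℝ, α a = ∫ r in Ioi (0:ℝ), (1 + r ^ 2) ^ N * Real.exp (2 * u a r) * r) :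
    StrictAnti α ∧
    (∀ α₀ : ℝ, (∃ v : ℝ → ℝ, IsSolAtLevel N α₀ v) ↔ α₀ ∈ Ioo 2 (2 * (N + 1))) ∧
    (∀ α₀ ∈ Ioo 2 (2 * (N + 1)), ∀ v w : ℝ → ℝ,
      IsSolAtLevel N α₀ v → IsSolAtLevel N α₀ w → EqOn v w (Ici 0)) := by
  have hprof : ∀ a, IsLogProfile N a (α a) (fun t => u a (exp t))
      (fun t => -(exp t * deriv (u a) (exp t))) := fun a => by
    have := (hu a).1.isLogProfile
    rwa [(hu a).2, ← hα a] at this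
  refine ⟨fun a b hab => (hprof a).total_lt_total (hprof b) hN0 hN1 hab, fun α₀ => ⟨?_, ?_⟩,
    fun α₀ _ v w hv hw => hv.eqOn hN0 hN1 hw⟩
  · rintro ⟨v, hv⟩
    exact ⟨hv.isLogProfile.two_lt_total hN0, hv.isLogProfile.total_lt hN0⟩
  · rintro ⟨h2, hlt⟩
    obtain ⟨a, ha⟩ := IsLogProfile.exists_total_lt hprof hN0 hN1 h2
    obtain ⟨b, hb⟩ := IsLogProfile.exists_lt_total hprof hN0 hN1 hlt
    obtain ⟨c, rfl⟩ := mem_range_of_exists_le_of_exists_ge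
      (IsLogProfile.continuous_total hprof hN0 hN1) ⟨a, ha.le⟩ ⟨b, hb.le⟩
    obtain ⟨h1, h2, h3, h4⟩ := (hu c).1
    exact ⟨u c, h1, h2, h3, h4, (hα c).symm⟩
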